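/- arXiv:1203.2009 — 2 statements merged into one kernel-verified Lean document; each statement's English description precedes it below -/
import Mathlib

section
/- For all 2 ≤ n < l ≤ L−1, the following identity of rational functions holds: Sym[C(n) · (t_{L−1}^{(1)})^{−1} f_n^{x}(t^{(1)}) · (t_{L−1}^{(2)})^{−1} f_l^{y}(t^{(2)})] = (1/(x−y)) · Sym[(t_{L−1}^{(1)} t_{L−1}^{(2)})^{−1} (f_n^{x}(t^{(1)}) − f_n^{y}(t^{(1)}))(x f_l^{x}(t^{(2)}) − y f_l^{y}(t^{(2)}))]. Moreover, in the degenerate case where both copies carry the same parameter x, one has Sym[C(n) · (t_{L−1}^{(1)})^{−1} f_n^{x}(t^{(1)}) · (t_{L−1}^{(2)})^{−1} f_l^{x}(t^{(2)})] = 0. -/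
noncomputable section

open Finset

/-- `f₀(t^{(a)})`, with the convention `t₀^{(a)} = u 0 a` (hypothesised to be `1`). -/
def f0 (L : ℕ) (u : ℕ → ℕ → ℂ) (a : ℕ) : ℂ :=
  ∏ m ∈ Finset.Icc 1 (L - 1), (u (m - 1) a - u m a)⁻¹

/-- `f_n^v(t^{(a)})` for a parameter `v ∈ {x, y}`. -/
def fP (L : ℕ) (v : ℂ) (n : ℕ) (u : ℕ → ℕ → ℂ) (a : ℕ) : ℂ :=
  (1 - v * u (L - 1) a)⁻¹ *
    ∏ m ∈ (Finset.Icc 1 (L - 1)).erase n, (u (m - 1) a - u m a)⁻¹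

/-- `f_{l,k}^v(t^{(a)})`. -/
def fP2 (L : ℕ) (v : ℂ) (l k : ℕ) (u : ℕ → ℕ → ℂ) (a : ℕ) : ℂ :=
  (1 - v * u (L - 1) a)⁻¹ *
    ∏ m ∈ ((Finset.Icc 1 (L - 1)).erase l).erase k, (u (m - 1) a - u m a)⁻¹

/-- The family `t` with the variables `t m 1 ↔ t m 2` swapped for `m ∈ S`. -/
def swapOn (S : Finset ℕ) (t : ℕ → ℕ → ℂ) : ℕ → ℕ → ℂ :=
  fun m a => if m ∈ S then t m (3 - a) else t m a

/-- The symmetrisation over the group `(S₂)^{L-1}`: the sum of the values of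
`g` on all families obtained from `t` by swapping `t m 1 ↔ t m 2` for `m` in a
subset of `{1, …, L-1}`. -/
def symSum (L : ℕ) (t : ℕ → ℕ → ℂ) (g : (ℕ → ℕ → ℂ) → ℂ) : ℂ :=
  ∑ S ∈ (Finset.Icc 1 (L - 1)).powerset, g (swapOn S t)

/-- The factor `C(n)`. -/
def Cf (L n : ℕ) (u : ℕ → ℕ → ℂ) : ℂ :=
  (∑ m ∈ Finset.Icc n (L - 1),
      u m 1 * (-(u m 1 - u (m - 1) 2)⁻¹ + 2 * (u m 1 - u m 2)⁻¹))
  - (∑ m ∈ Finset.Icc n (L - 2), u m 1 * (u m 1 - u (m + 1) 2)⁻¹)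
  + (if n = 1 then u 1 1 * (u 1 1 - 1)⁻¹ else 0)

/-- local weight at level `m` -/
def wt (n l m : ℕ) (a b p q : ℂ) : ℂ :=
  (if m = n then 1 else (a - p)⁻¹) * (if m = l then 1 else (b - q)⁻¹)

/-- local part of `C(n)` -/
def cc (n m : ℕ) (a b p q : ℂ) : ℂ :=
  (if n ≤ m then p * (-(p - b)⁻¹ + 2 * (p - q)⁻¹) else 0) -
    (if n + 1 ≤ m then a * (a - q)⁻¹ else 0)

def Pr (n l k : ℕ) (u : ℕ → ℕ → ℂ) : ℂ :=
  ∏ m ∈ Finset.range k, wt n l (m+1) (u m 1) (u m 2) (u (m+1) 1) (u (m+1) 2)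

def Sm (n k : ℕ) (u : ℕ → ℕ → ℂ) : ℂ :=
  ∑ m ∈ Finset.range k, cc n (m+1) (u m 1) (u m 2) (u (m+1) 1) (u (m+1) 2)

def GG (n l : ℕ) (t : ℕ → ℕ → ℂ) : ℕ → ℂ → ℂ → ℂ
  | 0 => fun _ _ => 1 / 2
  | k + 1 => fun p q =>
      GG n l t k (t k 1) (t k 2) * wt n l (k+1) (t k 1) (t k 2) p q +
      GG n l t k (t k 2) (t k 1) * wt n l (k+1) (t k 2) (t k 1) p q

def RR (n l : ℕ) (t : ℕ → ℕ → ℂ) : ℕ → ℂ → ℂ → ℂ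
  | 0 => fun _ _ => 0
  | k + 1 => fun p q =>
      (RR n l t k (t k 1) (t k 2) +
        GG n l t k (t k 1) (t k 2) * cc n (k+1) (t k 1) (t k 2) p q)
          * wt n l (k+1) (t k 1) (t k 2) p q +
      (RR n l t k (t k 2) (t k 1) +
        GG n l t k (t k 2) (t k 1) * cc n (k+1) (t k 2) (t k 1) p q)
          * wt n l (k+1) (t k 2) (t k 1) p q

lemma GG_succ (n l : ℕ) (t : ℕ → ℕ → ℂ) (k : ℕ) (p q : ℂ) : GG n l t (k+1) p q =
      GG n l t k (t k 1) (t k 2) * wt n l (k+1) (t k 1) (t k 2) p q +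
      GG n l t k (t k 2) (t k 1) * wt n l (k+1) (t k 2) (t k 1) p q := rfl

lemma swapOn_insert_of_ne (S : Finset ℕ) (t : ℕ → ℕ → ℂ) (k m a : ℕ) (h : m ≠ k) :
    swapOn (insert k S) t m a = swapOn S t m a := by
  simp [swapOn, h]

lemma Pr_congr (n l k : ℕ) (u v : ℕ → ℕ → ℂ) (h : ∀ m ≤ k, ∀ a, u m a = v m a) :
    Pr n l k u = Pr n l k v := by
  unfold Pr
  refine Finset.prod_congr rfl fun m hm => ?_
  rw [Finset.mem_range] at hm
  simp only [h m (by omega), h (m+1) (by omega)]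

lemma Sm_congr (n k : ℕ) (u v : ℕ → ℕ → ℂ) (h : ∀ m ≤ k, ∀ a, u m a = v m a) :
    Sm n k u = Sm n k v := by
  unfold Sm
  refine Finset.sum_congr rfl fun m hm => ?_
  rw [Finset.mem_range] at hm
  simp only [h m (by omega), h (m+1) (by omega)]

lemma sum_step (k : ℕ) (t : ℕ → ℕ → ℂ) (g : (ℕ → ℕ → ℂ) → ℂ) :
    ∑ S ∈ (Finset.Icc 1 (k+1)).powerset, g (swapOn S t) =
      ∑ S ∈ (Finset.Icc 1 k).powerset, (g (swapOn S t) + g (swapOn (insert (k+1) S) t)) := by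
  have h : Finset.Icc 1 (k+1) = insert (k+1) (Finset.Icc 1 k) := by
    ext m; simp only [Finset.mem_Icc, Finset.mem_insert]; omega
  rw [h, Finset.sum_powerset_insert (by simp), Finset.sum_add_distrib]

lemma transfer (n l : ℕ) (t : ℕ → ℕ → ℂ) (h01 : t 0 1 = 1) (h02 : t 0 2 = 1) (k : ℕ) :
    (∀ h : ℂ → ℂ → ℂ, ∑ S ∈ (Finset.Icc 1 k).powerset,
      Pr n l k (swapOn S t) * h (swapOn S t k 1) (swapOn S t k 2) =
      GG n l t k (t k 1) (t k 2) * h (t k 1) (t k 2) +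
      GG n l t k (t k 2) (t k 1) * h (t k 2) (t k 1)) ∧
    (∀ h : ℂ → ℂ → ℂ, ∑ S ∈ (Finset.Icc 1 k).powerset,
      Sm n k (swapOn S t) * Pr n l k (swapOn S t) * h (swapOn S t k 1) (swapOn S t k 2) =
      RR n l t k (t k 1) (t k 2) * h (t k 1) (t k 2) +
      RR n l t k (t k 2) (t k 1) * h (t k 2) (t k 1)) := by
  induction k with
  | zero =>
    constructor
    · intro h
      simp [Pr, swapOn, GG, h01, h02]; ring
    · intro h
      simp [Sm, RR]
  | succ k ih =>
    obtain ⟨ih1, ih2⟩ := ih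
    have e1 : ∀ S ∈ (Finset.Icc 1 k).powerset, ∀ a, swapOn S t (k+1) a = t (k+1) a := by
      intro S hS a
      rw [Finset.mem_powerset] at hS
      have : k + 1 ∉ S := fun h => by have := hS h; simp at this
      simp [swapOn, this]
    have e2 : ∀ S : Finset ℕ, ∀ a, swapOn (insert (k+1) S) t (k+1) a = t (k+1) (3 - a) := by
      intro S a; simp [swapOn]
    have e3 : ∀ S : Finset ℕ, ∀ m ≤ k, ∀ a, swapOn (insert (k+1) S) t m a = swapOn S t m a := by
      intro S m hm a; exact swapOn_insert_of_ne _ _ _ _ _ (by omega)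
    constructor
    · intro h
      rw [sum_step k t (fun u => Pr n l (k+1) u * h (u (k+1) 1) (u (k+1) 2))]
      have := ih1 (fun a b => wt n l (k+1) a b (t (k+1) 1) (t (k+1) 2) * h (t (k+1) 1) (t (k+1) 2)
        + wt n l (k+1) a b (t (k+1) 2) (t (k+1) 1) * h (t (k+1) 2) (t (k+1) 1))
      trans
      · refine Eq.trans (Finset.sum_congr rfl fun S hS => ?_) this
        have hp : ∀ u, Pr n l (k+1) u = Pr n l k u *
          wt n l (k+1) (u k 1) (u k 2) (u (k+1) 1) (u (k+1) 2) := fun u => by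
            simp [Pr, Finset.prod_range_succ]
        simp only [hp, e1 S hS, e2, e3 S k le_rfl, Pr_congr n l k _ _ (e3 S)]
        ring
      · simp only [GG]; ring
    · intro h
      rw [sum_step k t (fun u => Sm n (k+1) u * Pr n l (k+1) u * h (u (k+1) 1) (u (k+1) 2))]
      have h1 := ih1 (fun a b => cc n (k+1) a b (t (k+1) 1) (t (k+1) 2) * wt n l (k+1) a b (t (k+1) 1) (t (k+1) 2) * h (t (k+1) 1) (t (k+1) 2)
        + cc n (k+1) a b (t (k+1) 2) (t (k+1) 1) * wt n l (k+1) a b (t (k+1) 2) (t (k+1) 1) * h (t (k+1) 2) (t (k+1) 1))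
      have h2 := ih2 (fun a b => wt n l (k+1) a b (t (k+1) 1) (t (k+1) 2) * h (t (k+1) 1) (t (k+1) 2)
        + wt n l (k+1) a b (t (k+1) 2) (t (k+1) 1) * h (t (k+1) 2) (t (k+1) 1))
      have h3 := congrArg₂ (· + ·) h1 h2
      simp only [← Finset.sum_add_distrib] at h3
      trans
      · refine Eq.trans (Finset.sum_congr rfl fun S hS => ?_) h3
        have hp : ∀ u, Pr n l (k+1) u = Pr n l k u *
          wt n l (k+1) (u k 1) (u k 2) (u (k+1) 1) (u (k+1) 2) := fun u => by
            simp [Pr, Finset.prod_range_succ]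
        have hs : ∀ u, Sm n (k+1) u = Sm n k u +
          cc n (k+1) (u k 1) (u k 2) (u (k+1) 1) (u (k+1) 2) := fun u => by
            simp [Sm, Finset.sum_range_succ]
        simp only [hp, hs, e1 S hS, e2, e3 S k le_rfl, Pr_congr n l k _ _ (e3 S),
          Sm_congr n k _ _ (e3 S)]
        ring
      · simp only [RR]; ring

lemma GG_symm (n l : ℕ) (t : ℕ → ℕ → ℂ) (hnl : n < l) (k : ℕ) (hk : k < n) (p q : ℂ) :
    GG n l t k p q = GG n l t k q p := by
  cases k with
  | zero => rfl
  | succ k =>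
    have ih := GG_symm n l t hnl k (by omega) (t k 1) (t k 2)
    simp only [GG, wt, if_neg (show k + 1 ≠ n by omega), if_neg (show k + 1 ≠ l by omega), ih]
    ring

lemma RR_zero (n l : ℕ) (t : ℕ → ℕ → ℂ) (k : ℕ) (hk : k < n) (p q : ℂ) :
    RR n l t k p q = 0 := by
  cases k with
  | zero => rfl
  | succ k =>
    have ih := RR_zero n l t k (by omega)
    simp [RR, ih, cc, show ¬ n ≤ k + 1 by omega, show ¬ n ≤ k by omega]

lemma alg_n (g a b p q : ℂ) (hpq : p - q ≠ 0) (hap : p - a ≠ 0) (hbp : p - b ≠ 0)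
    (haq : a - q ≠ 0) (hbq : b - q ≠ 0) (hap' : a - p ≠ 0) (hbp' : b - p ≠ 0) :
    g * (p * (-(p - b)⁻¹ + 2 * (p - q)⁻¹)) * (b - q)⁻¹ +
    g * (p * (-(p - a)⁻¹ + 2 * (p - q)⁻¹)) * (a - q)⁻¹ =
    p * (p - q)⁻¹ * ((g * (b - q)⁻¹ + g * (a - q)⁻¹) + (g * (b - p)⁻¹ + g * (a - p)⁻¹)) := by
  have h1 : (p - b)⁻¹ = - (b - p)⁻¹ := by rw [← neg_sub, inv_neg]
  have h2 : (p - a)⁻¹ = - (a - p)⁻¹ := by rw [← neg_sub, inv_neg]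
  rw [h1, h2]
  field_simp
  ring

lemma alg_mid (α β c d p q : ℂ) (hpq : p - q ≠ 0) (hcd : c - d ≠ 0)
    (hcp : c - p ≠ 0) (hcq : c - q ≠ 0) (hdp : d - p ≠ 0) (hdq : d - q ≠ 0) :
    (c * (c - d)⁻¹ * (β + α) + β * (p * (-(p - d)⁻¹ + 2 * (p - q)⁻¹) - c * (c - q)⁻¹))
      * ((c - p)⁻¹ * (d - q)⁻¹) +
    (d * (d - c)⁻¹ * (α + β) + α * (p * (-(p - c)⁻¹ + 2 * (p - q)⁻¹) - d * (d - q)⁻¹))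
      * ((d - p)⁻¹ * (c - q)⁻¹) =
    p * (p - q)⁻¹ * ((β * ((c - p)⁻¹ * (d - q)⁻¹) + α * ((d - p)⁻¹ * (c - q)⁻¹)) +
      (β * ((c - q)⁻¹ * (d - p)⁻¹) + α * ((d - q)⁻¹ * (c - p)⁻¹))) := by
  have h1 : (p - c)⁻¹ = - (c - p)⁻¹ := by rw [← neg_sub, inv_neg]
  have h2 : (p - d)⁻¹ = - (d - p)⁻¹ := by rw [← neg_sub, inv_neg]
  have h3 : (d - c)⁻¹ = - (c - d)⁻¹ := by rw [← neg_sub, inv_neg]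
  rw [h1, h2, h3]
  field_simp
  ring

lemma alg_l (α β c d p q : ℂ) (hpq : p - q ≠ 0) (hcd : c - d ≠ 0)
    (hcp : c - p ≠ 0) (hcq : c - q ≠ 0) (hdp : d - p ≠ 0) (hdq : d - q ≠ 0) :
    (c * (c - d)⁻¹ * (β + α) + β * (p * (-(p - d)⁻¹ + 2 * (p - q)⁻¹) - c * (c - q)⁻¹))
      * (c - p)⁻¹ +
    (d * (d - c)⁻¹ * (α + β) + α * (p * (-(p - c)⁻¹ + 2 * (p - q)⁻¹) - d * (d - q)⁻¹))
      * (d - p)⁻¹ =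
    p * (p - q)⁻¹ * ((β * (c - p)⁻¹ + α * (d - p)⁻¹) +
      (β * (c - q)⁻¹ + α * (d - q)⁻¹)) - (β * (c - q)⁻¹ + α * (d - q)⁻¹) := by
  have h1 : (p - c)⁻¹ = - (c - p)⁻¹ := by rw [← neg_sub, inv_neg]
  have h2 : (p - d)⁻¹ = - (d - p)⁻¹ := by rw [← neg_sub, inv_neg]
  have h3 : (d - c)⁻¹ = - (c - d)⁻¹ := by rw [← neg_sub, inv_neg]
  rw [h1, h2, h3]
  field_simp
  ring

/-- nondegeneracy of a pair at level `k` with respect to level `k-1` -/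
def Good (t : ℕ → ℕ → ℂ) (k : ℕ) (p q : ℂ) : Prop :=
  p - q ≠ 0 ∧ t k 1 - p ≠ 0 ∧ t k 2 - p ≠ 0 ∧ t k 1 - q ≠ 0 ∧ t k 2 - q ≠ 0

lemma RR_step_n (n l : ℕ) (t : ℕ → ℕ → ℂ) (hnl : n < l) (k : ℕ) (hk : k + 1 = n) (p q : ℂ)
    (h : Good t k p q) :
    RR n l t (k+1) p q = p * (p - q)⁻¹ * (GG n l t (k+1) p q + GG n l t (k+1) q p) := by
  obtain ⟨h1, h2, h3, h4, h5⟩ := h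
  have hs := GG_symm n l t hnl k (by omega) (t k 1) (t k 2)
  simp only [RR, GG, RR_zero n l t k (by omega), wt, cc, if_pos hk,
    if_neg (show k + 1 ≠ l by omega), if_pos (show n ≤ k + 1 by omega),
    if_neg (show ¬ n + 1 ≤ k + 1 by omega), hs, one_mul, sub_zero, zero_add]
  exact alg_n _ _ _ _ _ h1 (by rwa [← neg_sub, neg_ne_zero]) (by rwa [← neg_sub, neg_ne_zero])
    h4 h5 h2 h3

lemma RR_mid (n l : ℕ) (t : ℕ → ℕ → ℂ) (hn : 1 ≤ n) (hnl : n < l) (k : ℕ) (hk : n ≤ k)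
    (hkl : k < l) 
    (hg : ∀ m < k, Good t m (t (m+1) 1) (t (m+1) 2) ∧ Good t m (t (m+1) 2) (t (m+1) 1)) :
    ∀ p q, (p = t k 1 ∧ q = t k 2) ∨ (p = t k 2 ∧ q = t k 1) →
    RR n l t k p q = p * (p - q)⁻¹ * (GG n l t k p q + GG n l t k q p) := by
  induction k, hk using Nat.le_induction with
  | base =>
    intro p q hpq
    obtain ⟨j, rfl⟩ : ∃ j, n = j + 1 := ⟨n - 1, by omega⟩
    refine RR_step_n _ _ _ hnl j rfl p q ?_
    rcases hpq with ⟨rfl, rfl⟩ | ⟨rfl, rfl⟩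
    · exact (hg j (by omega)).1
    · exact (hg j (by omega)).2
  | succ k hk ih =>
    intro p q hpq
    have ih := ih (by omega) (fun m hm => hg m (by omega))
    have hG : Good t k p q := by
      rcases hpq with ⟨rfl, rfl⟩ | ⟨rfl, rfl⟩
      · exact (hg k (by omega)).1
      · exact (hg k (by omega)).2
    obtain ⟨h1, h2, h3, h4, h5⟩ := hG
    obtain ⟨j, rfl⟩ : ∃ j, k = j + 1 := ⟨k - 1, by omega⟩
    have hcd := (hg j (by omega)).1.1
    have := alg_mid (GG n l t (j+1) (t (j+1) 2) (t (j+1) 1))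
      (GG n l t (j+1) (t (j+1) 1) (t (j+1) 2)) _ _ p q h1 hcd h2 h4 h3 h5
    rw [RR, ih _ _ (Or.inl ⟨rfl, rfl⟩), ih _ _ (Or.inr ⟨rfl, rfl⟩), GG_succ _ _ _ (j+1) p q,
      GG_succ _ _ _ (j+1) q p]
    simp only [wt, cc, if_neg (show j + 1 + 1 ≠ n by omega),
      if_neg (show j + 1 + 1 ≠ l by omega), if_pos (show n ≤ j + 1 + 1 by omega),
      if_pos (show n + 1 ≤ j + 1 + 1 by omega)]
    exact this

lemma RR_top (n l : ℕ) (t : ℕ → ℕ → ℂ) (hn : 1 ≤ n) (hnl : n < l) (k : ℕ) (hk : l ≤ k)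
    (hg : ∀ m < k, Good t m (t (m+1) 1) (t (m+1) 2) ∧ Good t m (t (m+1) 2) (t (m+1) 1)) :
    ∀ p q, (p = t k 1 ∧ q = t k 2) ∨ (p = t k 2 ∧ q = t k 1) →
    RR n l t k p q = p * (p - q)⁻¹ * (GG n l t k p q + GG n l t k q p) - GG n l t k q p := by
  induction k, hk using Nat.le_induction with
  | base =>
    intro p q hpq
    obtain ⟨j, rfl⟩ : ∃ j, l = j + 1 + 1 := ⟨l - 2, by omega⟩
    have ih := RR_mid n (j+1+1) t hn hnl (j+1) (by omega) (by omega) (fun m hm => hg m (by omega))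
    have hG : Good t (j+1) p q := by
      rcases hpq with ⟨rfl, rfl⟩ | ⟨rfl, rfl⟩
      · exact (hg (j+1) (by omega)).1
      · exact (hg (j+1) (by omega)).2
    obtain ⟨h1, h2, h3, h4, h5⟩ := hG
    have hcd := (hg j (by omega)).1.1
    have := alg_l (GG n (j+1+1) t (j+1) (t (j+1) 2) (t (j+1) 1))
      (GG n (j+1+1) t (j+1) (t (j+1) 1) (t (j+1) 2)) _ _ p q h1 hcd h2 h4 h3 h5
    rw [RR, ih _ _ (Or.inl ⟨rfl, rfl⟩), ih _ _ (Or.inr ⟨rfl, rfl⟩), GG_succ _ _ _ (j+1) p q,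
      GG_succ _ _ _ (j+1) q p]
    simp only [wt, cc, if_neg (show j + 1 + 1 ≠ n by omega),
      if_true, if_pos (show n ≤ j + 1 + 1 by omega),
      if_pos (show n + 1 ≤ j + 1 + 1 by omega), mul_one]
    exact this
  | succ k hk ih =>
    intro p q hpq
    have ih := ih (fun m hm => hg m (by omega))
    have hG : Good t k p q := by
      rcases hpq with ⟨rfl, rfl⟩ | ⟨rfl, rfl⟩
      · exact (hg k (by omega)).1
      · exact (hg k (by omega)).2
    obtain ⟨h1, h2, h3, h4, h5⟩ := hG
    obtain ⟨j, rfl⟩ : ∃ j, k = j + 1 := ⟨k - 1, by omega⟩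
    have hcd := (hg j (by omega)).1.1
    have := alg_mid (GG n l t (j+1) (t (j+1) 2) (t (j+1) 1))
      (GG n l t (j+1) (t (j+1) 1) (t (j+1) 2)) _ _ p q h1 hcd h2 h4 h3 h5
    rw [RR, ih _ _ (Or.inl ⟨rfl, rfl⟩), ih _ _ (Or.inr ⟨rfl, rfl⟩), GG_succ _ _ _ (j+1) p q,
      GG_succ _ _ _ (j+1) q p]
    simp only [wt, cc, if_neg (show j + 1 + 1 ≠ n by omega),
      if_neg (show j + 1 + 1 ≠ l by omega), if_pos (show n ≤ j + 1 + 1 by omega),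
      if_pos (show n + 1 ≤ j + 1 + 1 by omega)]
    linear_combination this

lemma fP_eq (N : ℕ) (v : ℂ) (n : ℕ) (u : ℕ → ℕ → ℂ) (a : ℕ) :
    fP (N+1) v n u a = (1 - v * u N a)⁻¹ *
      ∏ m ∈ Finset.range N, (if m + 1 = n then 1 else (u m a - u (m+1) a)⁻¹) := by
  unfold fP
  simp only [Nat.add_sub_cancel]
  congr 1
  have h1 : ∏ m ∈ (Finset.Icc 1 N).erase n, (u (m - 1) a - u m a)⁻¹ =
      ∏ m ∈ Finset.Icc 1 N, (if m = n then 1 else (u (m - 1) a - u m a)⁻¹) := by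
    have e : (Finset.Icc 1 N).erase n = (Finset.Icc 1 N).filter (fun m => ¬ m = n) := by
      ext m; simp [and_comm]
    rw [e, Finset.prod_filter]
    refine Finset.prod_congr rfl fun m _ => ?_
    by_cases h : m = n <;> simp [h]
  have h2 : Finset.Icc 1 N = Finset.Ico 1 (N+1) := by ext m; simp only [Finset.mem_Icc, Finset.mem_Ico]; omega
  rw [h1, h2, Finset.prod_Ico_eq_prod_range]
  simp only [Nat.add_sub_cancel]
  refine Finset.prod_congr rfl fun m _ => ?_
  simp [add_comm 1 m]

lemma fP_mul (N : ℕ) (v w : ℂ) (n l : ℕ) (u : ℕ → ℕ → ℂ) :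
    fP (N+1) v n u 1 * fP (N+1) w l u 2 =
      (1 - v * u N 1)⁻¹ * (1 - w * u N 2)⁻¹ * Pr n l N u := by
  rw [fP_eq, fP_eq, Pr]
  simp only [wt, Finset.prod_mul_distrib]
  ring

lemma Cf_eq (N n : ℕ) (hn : 2 ≤ n) (hnN : n ≤ N) (u : ℕ → ℕ → ℂ) :
    Cf (N+1) n u = Sm n N u := by
  unfold Cf Sm
  rw [if_neg (by omega), add_zero]
  simp only [cc, Finset.sum_sub_distrib, Nat.add_sub_cancel]
  congr 1
  · rw [← Finset.sum_filter]
    refine Finset.sum_bij' (fun m _ => m - 1) (fun m _ => m + 1) ?_ ?_ ?_ ?_ ?_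
    · intro m hm; simp only [Finset.mem_Icc, Finset.mem_filter, Finset.mem_range] at *; omega
    · intro m hm; simp only [Finset.mem_Icc, Finset.mem_filter, Finset.mem_range] at *; omega
    · intro m hm; simp only [Finset.mem_Icc] at *; omega
    · intro m hm; simp
    · intro m hm
      simp only [Finset.mem_Icc] at hm
      rw [show m - 1 + 1 = m by omega]
  · rw [← Finset.sum_filter]
    refine Finset.sum_congr ?_ fun _ _ => rfl
    ext m; simp only [Finset.mem_Icc, Finset.mem_filter, Finset.mem_range]; omega

theorem stmt11 (L : ℕ) (hL : 2 ≤ L) (t : ℕ → ℕ → ℂ) (x y : ℂ)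
    (ht01 : t 0 1 = 1) (ht02 : t 0 2 = 1)
    (hadj : ∀ m, 1 ≤ m → m ≤ L - 1 → ∀ a b, (a = 1 ∨ a = 2) → (b = 1 ∨ b = 2) →
      t (m - 1) a ≠ t m b)
    (hver : ∀ m, 1 ≤ m → m ≤ L - 1 → t m 1 ≠ t m 2)
    (hxt : ∀ a, (a = 1 ∨ a = 2) → 1 - x * t (L - 1) a ≠ 0)
    (hyt : ∀ a, (a = 1 ∨ a = 2) → 1 - y * t (L - 1) a ≠ 0)
    (htL1 : t (L - 1) 1 ≠ 0) (htL2 : t (L - 1) 2 ≠ 0)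
    (hxy : x ≠ y) (hx1 : x ≠ 1) :
    -- Statement 11 (Lemma `n < l`, case `n ≥ 2`): generic identity and the
    -- degenerate identity where both copies carry the parameter `x`.
    ∀ n l, 2 ≤ n → n < l → l ≤ L - 1 →
      (symSum L t (fun u => Cf L n u * ((u (L - 1) 1)⁻¹ * fP L x n u 1) *
          ((u (L - 1) 2)⁻¹ * fP L y l u 2))
        = 1 / (x - y) *
            symSum L t (fun u => (u (L - 1) 1 * u (L - 1) 2)⁻¹ *
              ((fP L x n u 1 - fP L y n u 1) *
                (x * fP L x l u 2 - y * fP L y l u 2))))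
      ∧
      (symSum L t (fun u => Cf L n u * ((u (L - 1) 1)⁻¹ * fP L x n u 1) *
          ((u (L - 1) 2)⁻¹ * fP L x l u 2)) = 0) := by
  intro n l hn hnl hl
  obtain ⟨N, rfl⟩ : ∃ N, L = N + 1 := ⟨L - 1, by omega⟩
  simp only [Nat.add_sub_cancel] at *
  have hg : ∀ m < N, Good t m (t (m+1) 1) (t (m+1) 2) ∧ Good t m (t (m+1) 2) (t (m+1) 1) := by
    intro m hm
    have hv := hver (m+1) (by omega) (by omega)
    have ha := hadj (m+1) (by omega) (by omega)
    simp only [Nat.add_sub_cancel] at ha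
    have h11 := ha 1 1 (by simp) (by simp)
    have h12 := ha 1 2 (by simp) (by simp)
    have h21 := ha 2 1 (by simp) (by simp)
    have h22 := ha 2 2 (by simp) (by simp)
    simp only [Good, sub_ne_zero]
    exact ⟨⟨hv, h11, h21, h12, h22⟩, ⟨hv.symm, h12, h22, h11, h21⟩⟩
  have hR := RR_top n l t (by omega) hnl N hl hg
  have hR1 := hR _ _ (Or.inl ⟨rfl, rfl⟩)
  have hR2 := hR _ _ (Or.inr ⟨rfl, rfl⟩)
  obtain ⟨T1, T2⟩ := transfer n l t ht01 ht02 N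
  have hpq : t N 1 - t N 2 ≠ 0 := sub_ne_zero.2 (hver N (by omega) le_rfl)
  have hneg : (t N 2 - t N 1)⁻¹ = - (t N 1 - t N 2)⁻¹ := by rw [← neg_sub, inv_neg]
  have key : ∀ z w : ℂ, symSum (N+1) t (fun u => Cf (N+1) n u * ((u N 1)⁻¹ * fP (N+1) z n u 1) *
          ((u N 2)⁻¹ * fP (N+1) w l u 2)) =
      (t N 1 * GG n l t N (t N 1) (t N 2) + t N 2 * GG n l t N (t N 2) (t N 1)) *
        (t N 1 - t N 2)⁻¹ * ((t N 1)⁻¹ * (t N 2)⁻¹) *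
        ((1 - z * t N 1)⁻¹ * (1 - w * t N 2)⁻¹ - (1 - z * t N 2)⁻¹ * (1 - w * t N 1)⁻¹) := by
    intro z w
    have h := T2 (fun p q => p⁻¹ * q⁻¹ * ((1 - z * p)⁻¹ * (1 - w * q)⁻¹))
    unfold symSum
    simp only [Nat.add_sub_cancel]
    trans
    · refine Eq.trans (Finset.sum_congr rfl fun S _ => ?_) h
      rw [Cf_eq N n hn (by omega)]
      linear_combination (Sm n N (swapOn S t) * (swapOn S t N 1)⁻¹ * (swapOn S t N 2)⁻¹) *
        fP_mul N z w n l (swapOn S t)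
    · rw [hR1, hR2, hneg]
      generalize GG n l t N (t N 1) (t N 2) = γ
      generalize GG n l t N (t N 2) (t N 1) = δ
      have e1 : t N 1 * (t N 1 - t N 2)⁻¹ * (γ + δ) - δ =
          (t N 1 * γ + t N 2 * δ) * (t N 1 - t N 2)⁻¹ := by field_simp; ring
      have e2 : t N 2 * -(t N 1 - t N 2)⁻¹ * (δ + γ) - γ =
          -((t N 1 * γ + t N 2 * δ) * (t N 1 - t N 2)⁻¹) := by field_simp; ring
      rw [e1, e2]
      ring
  refine ⟨?_, ?_⟩
  · rw [key]
    have h := T1 (fun p q => p⁻¹ * q⁻¹ * (((1 - x * p)⁻¹ - (1 - y * p)⁻¹) *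
      (x * (1 - x * q)⁻¹ - y * (1 - y * q)⁻¹)))
    have h' : symSum (N+1) t (fun u => (u N 1 * u N 2)⁻¹ *
              ((fP (N+1) x n u 1 - fP (N+1) y n u 1) *
                (x * fP (N+1) x l u 2 - y * fP (N+1) y l u 2))) =
        ∑ S ∈ (Finset.Icc 1 N).powerset, Pr n l N (swapOn S t) *
        ((swapOn S t N 1)⁻¹ * (swapOn S t N 2)⁻¹ *
          (((1 - x * swapOn S t N 1)⁻¹ - (1 - y * swapOn S t N 1)⁻¹) *
            (x * (1 - x * swapOn S t N 2)⁻¹ - y * (1 - y * swapOn S t N 2)⁻¹))) := by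
      unfold symSum
      simp only [Nat.add_sub_cancel]
      refine Finset.sum_congr rfl fun S _ => ?_
      rw [mul_inv]
      linear_combination ((swapOn S t N 1)⁻¹ * (swapOn S t N 2)⁻¹) *
        (x * fP_mul N x x n l (swapOn S t) - y * fP_mul N x y n l (swapOn S t)
         - x * fP_mul N y x n l (swapOn S t) + y * fP_mul N y y n l (swapOn S t))
    rw [h', h]
    clear h h' T1 T2 key hR hR1 hR2 hg hadj hver
    have hx1' := hxt 1 (by simp)
    have hx2' := hxt 2 (by simp)
    have hy1' := hyt 1 (by simp)
    have hy2' := hyt 2 (by simp)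
    have hxy' : x - y ≠ 0 := sub_ne_zero.2 hxy
    generalize GG n l t N (t N 1) (t N 2) = γ
    generalize GG n l t N (t N 2) (t N 1) = δ
    generalize t N 1 = p at *
    generalize t N 2 = q at *
    have a1 : ∀ p, 1 - x * p ≠ 0 → 1 - y * p ≠ 0 → (1 - x * p)⁻¹ - (1 - y * p)⁻¹ =
        (x - y) * p * ((1 - x * p)⁻¹ * (1 - y * p)⁻¹) := by
      intro p h1 h2
      linear_combination -(1 - x * p)⁻¹ * mul_inv_cancel₀ h2 + (1 - y * p)⁻¹ * mul_inv_cancel₀ h1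
    have a2 : ∀ p, 1 - x * p ≠ 0 → 1 - y * p ≠ 0 → x * (1 - x * p)⁻¹ - y * (1 - y * p)⁻¹ =
        (x - y) * ((1 - x * p)⁻¹ * (1 - y * p)⁻¹) := by
      intro p h1 h2
      linear_combination -x * (1 - x * p)⁻¹ * mul_inv_cancel₀ h2 +
        y * (1 - y * p)⁻¹ * mul_inv_cancel₀ h1
    have a3 : (1 - x * p)⁻¹ * (1 - y * q)⁻¹ - (1 - x * q)⁻¹ * (1 - y * p)⁻¹ =
        (x - y) * (p - q) * ((1 - x * p)⁻¹ * (1 - y * p)⁻¹ * ((1 - x * q)⁻¹ * (1 - y * q)⁻¹)) := by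
      linear_combination -(1 - x * p)⁻¹ * (1 - y * q)⁻¹ *
          (mul_inv_cancel₀ hy1' * ((1 - x * q) * (1 - x * q)⁻¹) + mul_inv_cancel₀ hx2') +
        (1 - x * q)⁻¹ * (1 - y * p)⁻¹ *
          (mul_inv_cancel₀ hx1' * ((1 - y * q) * (1 - y * q)⁻¹) + mul_inv_cancel₀ hy2')
    rw [a1 p hx1' hy1', a1 q hx2' hy2', a2 p hx1' hy1', a2 q hx2' hy2', a3]
    generalize (1 - x * p)⁻¹ * (1 - y * p)⁻¹ = A
    generalize (1 - x * q)⁻¹ * (1 - y * q)⁻¹ = B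
    field_simp
  · rw [key]
    ring
end
end

section
/- For all 1 ≤ n < l ≤ L−1 and all l ≤ k ≤ L−2, the following identity of rational functions holds: Sym[Σ_{m=l}^{k} (−t_{m+1}^{(1)} (t_{m+1}^{(1)} − t_m^{(2)})^{−1} + 2 t_m^{(1)} (t_m^{(1)} − t_m^{(2)})^{−1} − t_{m−1}^{(1)} (t_{m−1}^{(1)} − t_m^{(2)})^{−1}) · (t_{L−1}^{(1)})^{−1} f_n^{x}(t^{(1)}) · (t_{L−1}^{(2)})^{−1} f_l^{y}(t^{(2)})] = Sym[(t_k^{(1)} − t_{k+1}^{(2)})^{−1} (t_k^{(2)} − t_{k+1}^{(1)})^{−1} · (t_{L−1}^{(1)})^{−1} f_{n,k+1}^{x}(t^{(1)}) · t_{k+1}^{(2)} (t_{L−1}^{(2)})^{−1} f_l^{y}(t^{(2)})]. -/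
noncomputable section

open Finset

/-- partial product of inverse adjacent differences -/
def Qp (s : Finset ℕ) (u : ℕ → ℕ → ℂ) (a : ℕ) : ℂ :=
  ∏ m ∈ s, (u (m - 1) a - u m a)⁻¹

theorem swap_ne {m j : ℕ} (h : j ≠ m) (u : ℕ → ℕ → ℂ) (a : ℕ) :
    swapOn {m} u j a = u j a := by
  simp [swapOn, h]

theorem swap_one (m : ℕ) (u : ℕ → ℕ → ℂ) : swapOn {m} u m 1 = u m 2 := by
  simp [swapOn]

theorem swap_two (m : ℕ) (u : ℕ → ℕ → ℂ) : swapOn {m} u m 2 = u m 1 := by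
  simp [swapOn]

theorem Qp_swap {s : Finset ℕ} {m : ℕ} (h0 : 0 ∉ s) (h1 : m ∉ s) (h2 : m + 1 ∉ s)
    (u : ℕ → ℕ → ℂ) (a : ℕ) : Qp s (swapOn {m} u) a = Qp s u a := by
  unfold Qp
  refine Finset.prod_congr rfl fun j hj => ?_
  have a0 : j ≠ 0 := fun h => h0 (h ▸ hj)
  have a1 : j ≠ m := fun h => h1 (h ▸ hj)
  have a2 : j ≠ m + 1 := fun h => h2 (h ▸ hj)
  rw [swap_ne a1, swap_ne (by omega)]

theorem Qp_erase {s : Finset ℕ} {m : ℕ} (h : m ∈ s) (u : ℕ → ℕ → ℂ) (a : ℕ) :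
    Qp s u a = (u (m - 1) a - u m a)⁻¹ * Qp (s.erase m) u a :=
  (Finset.mul_prod_erase s _ h).symm

theorem symSum_congr_swap {L : ℕ} {t : ℕ → ℕ → ℂ} {g h : (ℕ → ℕ → ℂ) → ℂ} (m : ℕ)
    (hm : m ∈ Finset.Icc 1 (L - 1))
    (H : ∀ S, g (swapOn S t) + g (swapOn {m} (swapOn S t))
      = h (swapOn S t) + h (swapOn {m} (swapOn S t))) :
    symSum L t g = symSum L t h := by
  unfold symSum
  rw [← Finset.insert_erase hm, Finset.sum_powerset_insert (Finset.notMem_erase _ _),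
    Finset.sum_powerset_insert (Finset.notMem_erase _ _), ← Finset.sum_add_distrib,
    ← Finset.sum_add_distrib]
  refine Finset.sum_congr rfl fun S hS => ?_
  have hmS : m ∉ S := fun hh => by
    have := Finset.mem_powerset.1 hS hh
    simp at this
  have e : swapOn (insert m S) t = swapOn {m} (swapOn S t) := by
    funext j a
    by_cases hj : j = m
    · subst hj; simp [swapOn, hmS]
    · simp [swapOn, hj]
  rw [e]
  exact H S

theorem symSum_add (L : ℕ) (t : ℕ → ℕ → ℂ) (g h : (ℕ → ℕ → ℂ) → ℂ) :
    symSum L t (fun u => g u + h u) = symSum L t g + symSum L t h := by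
  unfold symSum; exact Finset.sum_add_distrib

theorem key_base (p a b c d : ℂ) (h1 : p - a ≠ 0) (h2 : p - b ≠ 0) (h3 : a - c ≠ 0)
    (h4 : b - c ≠ 0) (h5 : a - d ≠ 0) (h6 : b - d ≠ 0) (h7 : a - b ≠ 0) :
    (-(c * (c - b)⁻¹) + 2 * (a * (a - b)⁻¹) - p * (p - b)⁻¹) * (p - a)⁻¹ * (a - c)⁻¹ * (b - d)⁻¹
    + (-(c * (c - a)⁻¹) + 2 * (b * (b - a)⁻¹) - p * (p - a)⁻¹) * (p - b)⁻¹ * (b - c)⁻¹ * (a - d)⁻¹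
    = (a - d)⁻¹ * (b - c)⁻¹ * (p - a)⁻¹ * d * (b - d)⁻¹
    + (b - d)⁻¹ * (a - c)⁻¹ * (p - b)⁻¹ * d * (a - d)⁻¹ := by
  rw [← neg_sub b c, ← neg_sub a c, ← neg_sub a b]
  simp only [inv_neg]
  field_simp
  ring

theorem key_step (p q a b c d : ℂ) (h1 : p - a ≠ 0) (h2 : p - b ≠ 0) (h3 : a - c ≠ 0)
    (h4 : b - c ≠ 0) (h5 : a - d ≠ 0) (h6 : b - d ≠ 0) (h7 : a - b ≠ 0)
    (h8 : q - a ≠ 0) (h9 : q - b ≠ 0) :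
    ((p - b)⁻¹ * (q - a)⁻¹ * (a - c)⁻¹ * b * (q - b)⁻¹ * (b - d)⁻¹
     + (-(c * (c - b)⁻¹) + 2 * (a * (a - b)⁻¹) - p * (p - b)⁻¹)
        * (p - a)⁻¹ * (a - c)⁻¹ * (q - b)⁻¹ * (b - d)⁻¹)
    + ((p - a)⁻¹ * (q - b)⁻¹ * (b - c)⁻¹ * a * (q - a)⁻¹ * (a - d)⁻¹
     + (-(c * (c - a)⁻¹) + 2 * (b * (b - a)⁻¹) - p * (p - a)⁻¹)
        * (p - b)⁻¹ * (b - c)⁻¹ * (q - a)⁻¹ * (a - d)⁻¹)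
    = (a - d)⁻¹ * (b - c)⁻¹ * (p - a)⁻¹ * d * (q - b)⁻¹ * (b - d)⁻¹
    + (b - d)⁻¹ * (a - c)⁻¹ * (p - b)⁻¹ * d * (q - a)⁻¹ * (a - d)⁻¹ := by
  rw [← neg_sub b c, ← neg_sub a c, ← neg_sub a b]
  simp only [inv_neg]
  field_simp
  ring

/-- nondegeneracy around index `m` -/
theorem good_swapOn {L : ℕ} {t : ℕ → ℕ → ℂ}
    (hadj : ∀ m, 1 ≤ m → m ≤ L - 1 → ∀ a b, (a = 1 ∨ a = 2) → (b = 1 ∨ b = 2) →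
      t (m - 1) a ≠ t m b)
    (hver : ∀ m, 1 ≤ m → m ≤ L - 1 → t m 1 ≠ t m 2) (S : Finset ℕ) :
    (∀ m, 1 ≤ m → m ≤ L - 1 → ∀ a b, (a = 1 ∨ a = 2) → (b = 1 ∨ b = 2) →
      swapOn S t (m - 1) a - swapOn S t m b ≠ 0) ∧
    (∀ m, 1 ≤ m → m ≤ L - 1 → swapOn S t m 1 - swapOn S t m 2 ≠ 0) := by
  constructor
  · intro m h1 h2 a b ha hb
    rw [sub_ne_zero]
    unfold swapOn
    split_ifs <;> apply hadj m h1 h2 <;> omega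
  · intro m h1 h2
    rw [sub_ne_zero]
    unfold swapOn
    split_ifs
    · exact (hver m h1 h2).symm
    · exact hver m h1 h2

theorem stmt13 (L : ℕ) (hL : 2 ≤ L) (t : ℕ → ℕ → ℂ) (x y : ℂ)
    (ht01 : t 0 1 = 1) (ht02 : t 0 2 = 1)
    (hadj : ∀ m, 1 ≤ m → m ≤ L - 1 → ∀ a b, (a = 1 ∨ a = 2) → (b = 1 ∨ b = 2) →
      t (m - 1) a ≠ t m b)
    (hver : ∀ m, 1 ≤ m → m ≤ L - 1 → t m 1 ≠ t m 2)
    (hxt : ∀ a, (a = 1 ∨ a = 2) → 1 - x * t (L - 1) a ≠ 0)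
    (hyt : ∀ a, (a = 1 ∨ a = 2) → 1 - y * t (L - 1) a ≠ 0)
    (htL1 : t (L - 1) 1 ≠ 0) (htL2 : t (L - 1) 2 ≠ 0)
    (hxy : x ≠ y) (hx1 : x ≠ 1) :
    -- Statement 13: the inductive claim (3.6 in the proof of Lemma `n < l`).
    ∀ n l k, 1 ≤ n → n < l → l ≤ L - 1 → l ≤ k → k ≤ L - 2 →
      symSum L t (fun u =>
          (∑ m ∈ Finset.Icc l k,
            (-(u (m + 1) 1 * (u (m + 1) 1 - u m 2)⁻¹)
              + 2 * (u m 1 * (u m 1 - u m 2)⁻¹)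
              - u (m - 1) 1 * (u (m - 1) 1 - u m 2)⁻¹)) *
          ((u (L - 1) 1)⁻¹ * fP L x n u 1) * ((u (L - 1) 2)⁻¹ * fP L y l u 2))
        = symSum L t (fun u =>
            (u k 1 - u (k + 1) 2)⁻¹ * (u k 2 - u (k + 1) 1)⁻¹ *
            ((u (L - 1) 1)⁻¹ * fP2 L x n (k + 1) u 1) *
            (u (k + 1) 2 * (u (L - 1) 2)⁻¹ * fP L y l u 2)) := by
  intro n l k hn hnl hlL hlk
  induction k, hlk using Nat.le_induction with
  | base =>
    intro hk
    refine symSum_congr_swap l (by simp; omega) fun S => ?_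
    obtain ⟨G, V⟩ := good_swapOn hadj hver S
    generalize swapOn S t = u at G V
    have A := G l (by omega) (by omega)
    have B := G (l + 1) (by omega) (by omega)
    have C := V l (by omega) (by omega)
    rw [Nat.add_sub_cancel] at B
    have K := key_base (u (l - 1) 1) (u l 1) (u l 2) (u (l + 1) 1) (u (l + 1) 2)
      (A 1 1 (by simp) (by simp)) (A 1 2 (by simp) (by simp)) (B 1 1 (by simp) (by simp))
      (B 2 1 (by simp) (by simp)) (B 1 2 (by simp) (by simp)) (B 2 2 (by simp) (by simp)) C
    have F1 : ∀ w : ℕ → ℕ → ℂ, fP L x n w 1 = (1 - x * w (L - 1) 1)⁻¹ *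
        ((w (l - 1) 1 - w l 1)⁻¹ * ((w l 1 - w (l + 1) 1)⁻¹ *
          Qp ((((Finset.Icc 1 (L - 1)).erase n).erase (l + 1)).erase l) w 1)) := by
      intro w
      change _ * Qp _ w 1 = _
      rw [Qp_erase (m := l + 1) (by simp; omega), Qp_erase (m := l) (by simp; omega),
        Nat.add_sub_cancel]
      ring
    have F2 : ∀ w : ℕ → ℕ → ℂ, fP2 L x n (l + 1) w 1 = (1 - x * w (L - 1) 1)⁻¹ *
        ((w (l - 1) 1 - w l 1)⁻¹ *
          Qp ((((Finset.Icc 1 (L - 1)).erase n).erase (l + 1)).erase l) w 1) := by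
      intro w
      change _ * Qp _ w 1 = _
      rw [Qp_erase (m := l) (by simp; omega)]
    have F3 : ∀ w : ℕ → ℕ → ℂ, fP L y l w 2 = (1 - y * w (L - 1) 2)⁻¹ *
        ((w l 2 - w (l + 1) 2)⁻¹ *
          Qp (((Finset.Icc 1 (L - 1)).erase l).erase (l + 1)) w 2) := by
      intro w
      change _ * Qp _ w 2 = _
      rw [Qp_erase (m := l + 1) (by simp; omega), Nat.add_sub_cancel]
    simp only [Finset.Icc_self, Finset.sum_singleton, F1, F2, F3]
    rw [Qp_swap (by simp) (by simp) (by simp), Qp_swap (by simp) (by simp) (by simp)]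
    simp only [swap_one, swap_two, swap_ne (show l + 1 ≠ l by omega),
      swap_ne (show l - 1 ≠ l by omega), swap_ne (show L - 1 ≠ l by omega)]
    generalize Qp _ u 1 = Q1
    generalize Qp _ u 2 = Q2
    linear_combination ((u (L - 1) 1)⁻¹ * (1 - x * u (L - 1) 1)⁻¹ * Q1 *
      (u (L - 1) 2)⁻¹ * (1 - y * u (L - 1) 2)⁻¹ * Q2) * K
  | succ k hlk ih =>
    intro hk
    simp only [Finset.sum_Icc_succ_top (show l ≤ k + 1 by omega), add_mul]
    rw [symSum_add, ih (by omega), ← symSum_add]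
    refine symSum_congr_swap (k + 1) (by simp; omega) fun S => ?_
    obtain ⟨G, V⟩ := good_swapOn hadj hver S
    generalize swapOn S t = u at G V
    have A := G (k + 1) (by omega) (by omega)
    have B := G (k + 1 + 1) (by omega) (by omega)
    have C := V (k + 1) (by omega) (by omega)
    rw [Nat.add_sub_cancel] at A B
    have K := key_step (u k 1) (u k 2) (u (k + 1) 1) (u (k + 1) 2)
      (u (k + 1 + 1) 1) (u (k + 1 + 1) 2)
      (A 1 1 (by simp) (by simp)) (A 1 2 (by simp) (by simp)) (B 1 1 (by simp) (by simp))
      (B 2 1 (by simp) (by simp)) (B 1 2 (by simp) (by simp)) (B 2 2 (by simp) (by simp)) C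
      (A 2 1 (by simp) (by simp)) (A 2 2 (by simp) (by simp))
    have F1 : ∀ w : ℕ → ℕ → ℂ, fP L x n w 1 = (1 - x * w (L - 1) 1)⁻¹ *
        ((w k 1 - w (k + 1) 1)⁻¹ * ((w (k + 1) 1 - w (k + 1 + 1) 1)⁻¹ *
          Qp ((((Finset.Icc 1 (L - 1)).erase n).erase (k + 1)).erase (k + 1 + 1)) w 1)) := by
      intro w
      change _ * Qp _ w 1 = _
      rw [Qp_erase (m := k + 1) (by simp; omega), Qp_erase (m := k + 1 + 1) (by simp; omega),
        Nat.add_sub_cancel, Nat.add_sub_cancel]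
    have F2 : ∀ w : ℕ → ℕ → ℂ, fP2 L x n (k + 1) w 1 = (1 - x * w (L - 1) 1)⁻¹ *
        ((w (k + 1) 1 - w (k + 1 + 1) 1)⁻¹ *
          Qp ((((Finset.Icc 1 (L - 1)).erase n).erase (k + 1)).erase (k + 1 + 1)) w 1) := by
      intro w
      change _ * Qp _ w 1 = _
      rw [Qp_erase (m := k + 1 + 1) (by simp; omega), Nat.add_sub_cancel]
    have F2' : ∀ w : ℕ → ℕ → ℂ, fP2 L x n (k + 1 + 1) w 1 = (1 - x * w (L - 1) 1)⁻¹ *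
        ((w k 1 - w (k + 1) 1)⁻¹ *
          Qp ((((Finset.Icc 1 (L - 1)).erase n).erase (k + 1)).erase (k + 1 + 1)) w 1) := by
      intro w
      change _ * Qp _ w 1 = _
      rw [Qp_erase (m := k + 1) (by simp; omega), Nat.add_sub_cancel,
        Finset.erase_right_comm (a := k + 1 + 1)]
    have F3 : ∀ w : ℕ → ℕ → ℂ, fP L y l w 2 = (1 - y * w (L - 1) 2)⁻¹ *
        ((w k 2 - w (k + 1) 2)⁻¹ * ((w (k + 1) 2 - w (k + 1 + 1) 2)⁻¹ *
          Qp ((((Finset.Icc 1 (L - 1)).erase l).erase (k + 1)).erase (k + 1 + 1)) w 2)) := by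
      intro w
      change _ * Qp _ w 2 = _
      rw [Qp_erase (m := k + 1) (by simp; omega), Qp_erase (m := k + 1 + 1) (by simp; omega),
        Nat.add_sub_cancel, Nat.add_sub_cancel]
    simp only [F1, F2, F2', F3, Nat.add_sub_cancel]
    rw [Qp_swap (by simp) (by simp) (by simp), Qp_swap (by simp) (by simp) (by simp)]
    simp only [swap_one, swap_two, swap_ne (show k + 1 + 1 ≠ k + 1 by omega),
      swap_ne (show k ≠ k + 1 by omega), swap_ne (show L - 1 ≠ k + 1 by omega)]
    generalize Qp _ u 1 = Q1
    generalize Qp _ u 2 = Q2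
    linear_combination ((u (L - 1) 1)⁻¹ * (1 - x * u (L - 1) 1)⁻¹ * Q1 *
      (u (L - 1) 2)⁻¹ * (1 - y * u (L - 1) 2)⁻¹ * Q2) * K
end
end
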